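/- Let α be a real number with 0 < α < 1, let f be continuous on [0, ∞) and such that J^α f is continuously differentiable on [0, ∞) with (J^α f)(0) = 0. Then for every t > 0, D∗^α (J^α f) (t) = f(t), i.e., the Caputo fractional derivative of order α is a left inverse of the Riemann–Liouville fractional integral of order α on such functions. -/

import Mathlib

open Real MeasureTheory intervalIntegral

/-- The Riemann–Liouville fractional integral of order `α`. -/
noncomputable def rlIntegral (α : ℝ) (f : ℝ → ℝ) (t : ℝ) : ℝ :=
  (1 / Real.Gamma α) * ∫ τ in (0:ℝ)..t, (t - τ) ^ (α - 1) * f τ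

/-- The Caputo fractional derivative of order `α` with `0 < α < 1`:
`D∗^α g (t) = (1/Γ(1−α)) ∫₀ᵗ (t − τ)^(−α) g'(τ) dτ`. -/
noncomputable def caputoDeriv1 (α : ℝ) (g : ℝ → ℝ) (t : ℝ) : ℝ :=
  (1 / Real.Gamma (1 - α)) * ∫ τ in (0:ℝ)..t, (t - τ) ^ (-α) * deriv g τ

lemma aux_ii_congr {t : ℝ} (ht : 0 ≤ t) {u v : ℝ → ℝ} (h : ∀ s ∈ Set.Ioo 0 t, u s = v s) :
    ∫ s in (0:ℝ)..t, u s = ∫ s in (0:ℝ)..t, v s := by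
  rw [intervalIntegral.integral_of_le ht, intervalIntegral.integral_of_le ht,
    integral_Ioc_eq_integral_Ioo, integral_Ioc_eq_integral_Ioo]
  exact setIntegral_congr_fun measurableSet_Ioo h

lemma aux_ii_indicator {t : ℝ} (ht : 0 ≤ t) {u v : ℝ → ℝ}
    (h : ∀ s, u s = (Set.Ioo 0 t).indicator v s) :
    ∫ s, u s = ∫ s in (0:ℝ)..t, v s := by
  rw [intervalIntegral.integral_of_le ht, integral_Ioc_eq_integral_Ioo,
    ← MeasureTheory.integral_indicator measurableSet_Ioo]
  exact integral_congr_ae (Filter.Eventually.of_forall h)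

lemma aux_conv_eq {T x : ℝ} (hx : 0 ≤ x) (hxT : x ≤ T) (u v : ℝ → ℝ) :
    (convolution ((Set.Ioo 0 T).indicator u) ((Set.Ioo 0 T).indicator v)
      (ContinuousLinearMap.mul ℝ ℝ) volume) x = ∫ s in (0:ℝ)..x, u s * v (x - s) := by
  unfold convolution
  apply aux_ii_indicator hx
  intro s
  simp only [ContinuousLinearMap.mul_apply', Set.indicator, Set.mem_Ioo]
  by_cases h1 : 0 < s ∧ s < x
  · rw [if_pos ⟨h1.1, by linarith⟩, if_pos ⟨by linarith, by linarith⟩, if_pos h1]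
  · rw [if_neg h1]
    by_cases h2 : 0 < s ∧ s < T
    · rw [if_neg (c := 0 < x - s ∧ x - s < T), mul_zero]
      rintro ⟨h3, h4⟩
      exact h1 ⟨h2.1, by linarith⟩
    · rw [if_neg h2, zero_mul]

lemma aux_beta {a b x : ℝ} (ha : 0 < a) (hb : 0 < b) (hx : 0 < x) :
    ∫ s in (0:ℝ)..x, s ^ (a - 1) * (x - s) ^ (b - 1) =
      x ^ (a + b - 1) * (Real.Gamma a * Real.Gamma b / Real.Gamma (a + b)) := by
  have h := Complex.betaIntegral_scaled (a : ℂ) (b : ℂ) hx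
  rw [Complex.betaIntegral_eq_Gamma_mul_div _ _ (by simpa) (by simpa)] at h
  have e : ∫ s in (0:ℝ)..x, ((s : ℂ) ^ ((a : ℂ) - 1) * ((x : ℂ) - s) ^ ((b : ℂ) - 1)) =
      ((∫ s in (0:ℝ)..x, s ^ (a - 1) * (x - s) ^ (b - 1) : ℝ) : ℂ) := by
    rw [← intervalIntegral.integral_ofReal]
    apply intervalIntegral.integral_congr
    intro s hs
    rw [Set.uIcc_of_le hx.le] at hs
    simp only []
    push_cast
    rw [Complex.ofReal_cpow hs.1, Complex.ofReal_cpow (by linarith [hs.2])]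
    push_cast
    rfl
  rw [e] at h
  apply Complex.ofReal_injective
  rw [h]
  push_cast
  rw [Complex.ofReal_cpow hx.le, ← Complex.ofReal_add, Complex.Gamma_ofReal, Complex.Gamma_ofReal,
    Complex.Gamma_ofReal]
  push_cast
  rfl

lemma aux_ker_int {a : ℝ} (ha : 0 < a) (T : ℝ) :
    Integrable ((Set.Ioo 0 T).indicator (fun x : ℝ => x ^ (a - 1))) volume := by
  rw [integrable_indicator_iff measurableSet_Ioo]
  exact (intervalIntegral.intervalIntegrable_rpow' (a := 0) (b := T)
    (by linarith : -1 < a - 1)).1.mono_set Set.Ioo_subset_Ioc_self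

lemma aux_assoc {T : ℝ} {u f g : ℝ → ℝ} (hu : Continuous u)
    (hf : Integrable f volume) (hg : Integrable g volume) :
    convolution (convolution ((Set.Ioo 0 T).indicator u) f
      (ContinuousLinearMap.mul ℝ ℝ) volume) g (ContinuousLinearMap.mul ℝ ℝ) volume T =
    convolution ((Set.Ioo 0 T).indicator u) (convolution f g
      (ContinuousLinearMap.mul ℝ ℝ) volume) (ContinuousLinearMap.mul ℝ ℝ) volume T := by
  have hU : Integrable ((Set.Ioo 0 T).indicator u) volume := by
    rw [integrable_indicator_iff measurableSet_Ioo]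
    exact (hu.integrableOn_Icc (a := 0) (b := T)).mono_set Set.Ioo_subset_Icc_self
  obtain ⟨M, hM⟩ := (isCompact_Icc (a := (0:ℝ)) (b := T)).exists_bound_of_continuousOn
    hu.continuousOn
  apply convolution_assoc
  · intro x y z
    simp [mul_assoc]
  · exact hU.aestronglyMeasurable
  · exact hf.aestronglyMeasurable
  · exact hg.aestronglyMeasurable
  · exact hU.ae_convolution_exists _ hf
  · exact hf.norm.ae_convolution_exists _ hg.norm
  · have hk := hf.norm.integrable_convolution (ContinuousLinearMap.mul ℝ ℝ) hg.norm
    unfold ConvolutionExistsAt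
    simp only [ContinuousLinearMap.mul_apply']
    apply Integrable.bdd_mul (c := max M 0) (hk.comp_sub_left T) hU.norm.aestronglyMeasurable
    apply Filter.Eventually.of_forall
    intro s
    simp only [norm_norm, Set.indicator]
    split_ifs with h
    · exact (hM s (Set.Ioo_subset_Icc_self h)).trans (le_max_left _ _)
    · simp

lemma aux_semigroup {a b t : ℝ} (ha : 0 < a) (hb : 0 < b) (ht : 0 ≤ t) {u : ℝ → ℝ}
    (hu : Continuous u) :
    rlIntegral a (rlIntegral b u) t = rlIntegral (a + b) u t := by
  have key := aux_assoc (T := t) hu (aux_ker_int hb t) (aux_ker_int ha t)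
  have hL : convolution (convolution ((Set.Ioo 0 t).indicator u)
      ((Set.Ioo 0 t).indicator (fun x : ℝ => x ^ (b - 1)))
      (ContinuousLinearMap.mul ℝ ℝ) volume) ((Set.Ioo 0 t).indicator (fun x : ℝ => x ^ (a - 1)))
      (ContinuousLinearMap.mul ℝ ℝ) volume t =
      ∫ τ in (0:ℝ)..t, (t - τ) ^ (a - 1) * ∫ s in (0:ℝ)..τ, (τ - s) ^ (b - 1) * u s := by
    rw [convolution]
    apply aux_ii_indicator ht
    intro s
    simp only [ContinuousLinearMap.mul_apply']
    by_cases h1 : s ∈ Set.Ioo 0 t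
    · rw [Set.indicator_of_mem (by constructor <;> linarith [h1.1, h1.2]),
        Set.indicator_of_mem h1, aux_conv_eq h1.1.le h1.2.le, mul_comm]
      simp only [mul_comm]
    · rw [Set.indicator_of_notMem h1, Set.indicator_of_notMem, mul_zero]
      exact fun h2 => h1 ⟨by linarith [h2.2], by linarith [h2.1]⟩
  have hR : convolution ((Set.Ioo 0 t).indicator u) (convolution
      ((Set.Ioo 0 t).indicator (fun x : ℝ => x ^ (b - 1)))
      ((Set.Ioo 0 t).indicator (fun x : ℝ => x ^ (a - 1)))
      (ContinuousLinearMap.mul ℝ ℝ) volume) (ContinuousLinearMap.mul ℝ ℝ) volume t =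
      ∫ s in (0:ℝ)..t, (Real.Gamma b * Real.Gamma a / Real.Gamma (b + a)) *
        ((t - s) ^ (a + b - 1) * u s) := by
    rw [convolution]
    apply aux_ii_indicator ht
    intro s
    simp only [ContinuousLinearMap.mul_apply']
    by_cases h1 : s ∈ Set.Ioo 0 t
    · rw [Set.indicator_of_mem h1, Set.indicator_of_mem h1,
        aux_conv_eq (by linarith [h1.2]) (by linarith [h1.1]),
        aux_beta hb ha (by linarith [h1.2]), add_comm b a]
      ring
    · rw [Set.indicator_of_notMem h1, Set.indicator_of_notMem h1, zero_mul]
  rw [hL, hR, intervalIntegral.integral_const_mul] at key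
  unfold rlIntegral
  have e : ∫ τ in (0:ℝ)..t, (t - τ) ^ (a - 1) *
        (1 / Real.Gamma b * ∫ s in (0:ℝ)..τ, (τ - s) ^ (b - 1) * u s) =
      1 / Real.Gamma b *
      ∫ τ in (0:ℝ)..t, (t - τ) ^ (a - 1) * ∫ s in (0:ℝ)..τ, (τ - s) ^ (b - 1) * u s := by
    rw [← intervalIntegral.integral_const_mul]
    congr 1
    ext τ
    ring
  rw [e, key, add_comm b a]
  have h1 := (Real.Gamma_pos_of_pos ha).ne'
  have h2 := (Real.Gamma_pos_of_pos hb).ne'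
  field_simp

lemma aux_rl_congr {a t : ℝ} (ht : 0 ≤ t) {u v : ℝ → ℝ} (h : ∀ s ∈ Set.Ioo 0 t, u s = v s) :
    rlIntegral a u t = rlIntegral a v t := by
  unfold rlIntegral
  rw [aux_ii_congr ht (fun s hs => by rw [h s hs])]

lemma aux_rl_one (u : ℝ → ℝ) (t : ℝ) : rlIntegral 1 u t = ∫ s in (0:ℝ)..t, u s := by
  simp [rlIntegral]

lemma aux_rl_scale {a t : ℝ} (ht : 0 < t) (u : ℝ → ℝ) :
    rlIntegral a u t = t ^ a * rlIntegral a (fun s => u (t * s)) 1 := by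
  unfold rlIntegral
  have h := intervalIntegral.mul_integral_comp_mul_left (a := 0) (b := 1) t
    (f := fun τ => (t - τ) ^ (a - 1) * u τ)
  rw [mul_zero, mul_one] at h
  rw [← h]
  have e : ∫ x in (0:ℝ)..1, (t - t * x) ^ (a - 1) * u (t * x) =
      ∫ x in (0:ℝ)..1, t ^ (a - 1) * ((1 - x) ^ (a - 1) * u (t * x)) := by
    apply aux_ii_congr zero_le_one
    intro s hs
    rw [show t - t * s = t * (1 - s) by ring, Real.mul_rpow ht.le (by linarith [hs.2])]
    ring
  rw [e, intervalIntegral.integral_const_mul]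
  have : t ^ a = t * t ^ (a - 1) := by
    rw [Real.rpow_sub_one ht.ne']; field_simp
  rw [this]; ring

lemma aux_rl_cont {a : ℝ} (ha : 0 < a) {u : ℝ → ℝ} (hu : Continuous u) :
    ContinuousOn (rlIntegral a u) (Set.Ici 0) := by
  have h : Continuous (fun t : ℝ => rlIntegral a (fun s => u (t * s)) 1) := by
    unfold rlIntegral
    apply Continuous.mul continuous_const
    rw [continuous_iff_continuousAt]
    intro t₀
    obtain ⟨M, hM⟩ := (isCompact_Icc (a := -(|t₀| + 1)) (b := |t₀| + 1)).exists_bound_of_continuousOn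
      hu.continuousOn
    have hker : IntervalIntegrable (fun s : ℝ => (1 - s) ^ (a - 1)) volume 0 1 := by
      have := (intervalIntegral.intervalIntegrable_rpow' (a := 1) (b := 0)
        (by linarith : -1 < a - 1)).comp_sub_left 1
      simpa using this
    apply intervalIntegral.continuousAt_of_dominated_interval
      (bound := fun s => (1 - s) ^ (a - 1) * M)
    · apply Filter.Eventually.of_forall
      intro t
      exact (hker.def'.aestronglyMeasurable).mul
        (hu.comp (continuous_const.mul continuous_id)).aestronglyMeasurable
    · filter_upwards [Metric.ball_mem_nhds t₀ one_pos] with t ht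
      apply Filter.Eventually.of_forall
      intro s hs
      rw [Set.uIoc_of_le zero_le_one] at hs
      have h0 : 0 ≤ (1 - s) ^ (a - 1) := Real.rpow_nonneg (by linarith [hs.2]) _
      rw [norm_mul, Real.norm_of_nonneg h0]
      apply mul_le_mul_of_nonneg_left _ h0
      apply hM
      rw [Set.mem_Icc, ← abs_le, abs_mul, abs_of_pos hs.1]
      rw [Metric.mem_ball, Real.dist_eq] at ht
      have : |t| ≤ |t₀| + 1 := by
        have := abs_sub_abs_le_abs_sub t t₀
        linarith
      calc |t| * s ≤ |t| * 1 := mul_le_mul_of_nonneg_left hs.2 (abs_nonneg _)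
        _ ≤ _ := by linarith
    · exact hker.mul_const M
    · apply Filter.Eventually.of_forall
      intro s hs
      exact (continuous_const.mul (hu.comp (continuous_id.mul continuous_const))).continuousAt
  apply ContinuousOn.congr (f := fun t : ℝ => t ^ a * rlIntegral a (fun s => u (t * s)) 1)
  · exact ((Real.continuous_rpow_const ha.le).mul h).continuousOn
  · intro t ht
    rcases eq_or_lt_of_le (Set.mem_Ici.1 ht) with h0 | h0
    · rw [← h0]
      simp [rlIntegral, Real.zero_rpow ha.ne']
    · exact aux_rl_scale h0 u

/-- For `0 < α < 1`, the Caputo derivative is a left inverse of the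
Riemann–Liouville integral: `D∗^α (J^α f) (t) = f(t)` for `t > 0`, whenever `f` is
continuous on `[0,∞)` and `J^α f` is continuously differentiable on `[0,∞)` with
`(J^α f)(0) = 0`. -/
theorem caputoDeriv1_rlIntegral (α : ℝ) (hα₁ : 0 < α) (hα₂ : α < 1)
    (f : ℝ → ℝ) (hf : ContinuousOn f (Set.Ici 0))
    (hJ : ContDiffOn ℝ 1 (rlIntegral α f) (Set.Ici 0))
    (hJ0 : rlIntegral α f 0 = 0) :
    ∀ t : ℝ, 0 < t → caputoDeriv1 α (rlIntegral α f) t = f t := by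
  intro t ht
  set g := rlIntegral α f with hg
  have hmax : ∀ x : ℝ, max x 0 ∈ Set.Ici (0:ℝ) := fun x => Set.mem_Ici.2 (le_max_right x 0)
  have hcm : Continuous (fun x : ℝ => max x 0) := continuous_id.max continuous_const
  have hu : Continuous (fun x => f (max x 0)) := hf.comp_continuous hcm hmax
  set u := fun x => f (max x 0) with hudef
  have hh : Continuous (fun x => derivWithin g (Set.Ici 0) (max x 0)) :=
    (hJ.continuousOn_derivWithin (uniqueDiffOn_Ici 0) le_rfl).comp_continuous hcm hmax
  set h := fun x => derivWithin g (Set.Ici 0) (max x 0) with hhdef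
  have huf : ∀ x, 0 ≤ x → u x = f x := fun x hx => by simp [hudef, hx]
  have hd : ∀ x, 0 < x → HasDerivAt g (h x) x := by
    intro x hx
    have h1 : DifferentiableWithinAt ℝ g (Set.Ici 0) x :=
      hJ.differentiableOn one_ne_zero x hx.le
    have := h1.hasDerivWithinAt.hasDerivAt (Ici_mem_nhds hx)
    simpa [hhdef, hx.le] using this
  have hgint : ∀ x, 0 ≤ x → g x = rlIntegral 1 h x := by
    intro x hx
    rw [aux_rl_one, intervalIntegral.integral_eq_sub_of_hasDerivAt_of_le (f := g) hx
      (hJ.continuousOn.mono Set.Icc_subset_Ici_self) (fun y hy => hd y hy.1)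
      (hh.intervalIntegrable _ _), hJ0, sub_zero]
  have hgu : ∀ x, 0 ≤ x → g x = rlIntegral α u x := fun x hx =>
    aux_rl_congr hx fun s hs => (huf s hs.1.le).symm
  have hβ : 0 < 1 - α := by linarith
  have hcap : caputoDeriv1 α g t = rlIntegral (1 - α) h t := by
    unfold caputoDeriv1 rlIntegral
    rw [show 1 - α - 1 = -α by ring, aux_ii_congr ht.le (fun s hs => by rw [(hd s hs.1).deriv])]
  have hint : ∀ x, 0 ≤ x → ∫ s in (0:ℝ)..x, rlIntegral (1 - α) h s = ∫ s in (0:ℝ)..x, u s := by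
    intro x hx
    rw [← aux_rl_one, ← aux_rl_one, aux_semigroup one_pos hβ hx hh, add_comm,
      ← aux_semigroup hβ one_pos hx hh,
      aux_rl_congr hx (fun s hs => (hgint s hs.1.le).symm.trans (hgu s hs.1.le)),
      aux_semigroup hβ hα₁ hx hu, sub_add_cancel]
  rw [hcap, ← huf t ht.le]
  have hFc : ContinuousOn (rlIntegral (1 - α) h) (Set.Ici 0) := aux_rl_cont hβ hh
  have hFi : IntervalIntegrable (rlIntegral (1 - α) h) volume 0 t := by
    apply ContinuousOn.intervalIntegrable_of_Icc ht.le
    exact hFc.mono Set.Icc_subset_Ici_self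
  have hd1 : HasDerivAt (fun x => ∫ s in (0:ℝ)..x, rlIntegral (1 - α) h s)
      (rlIntegral (1 - α) h t) t :=
    intervalIntegral.integral_hasDerivAt_right hFi
      ((hFc.mono Set.Ioi_subset_Ici_self).stronglyMeasurableAtFilter isOpen_Ioi t ht)
      (hFc.continuousAt (Ici_mem_nhds ht))
  have hd2 : HasDerivAt (fun x => ∫ s in (0:ℝ)..x, u s) (u t) t :=
    hu.integral_hasStrictDerivAt 0 t |>.hasDerivAt
  refine hd1.unique (hd2.congr_of_eventuallyEq ?_)
  filter_upwards [Ici_mem_nhds ht] with x hx using hint x hx
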